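/- Let p, c, r be nonnegative real numbers. For α ∈ [0,p] and t ∈ [0,1] let O(r,α,t) be the set of pairs (β,γ) with 0 ≤ β ≤ p, 0 ≤ γ ≤ c and min( t·max(α,γ) + (1-t)·γ , t·γ + (1-t)·max(β,γ) ) ≤ r, and define V(r) = inf over α ∈ [0,p] of ( sup over t ∈ [0,1] of ( inf over (β,γ) ∈ O(r,α,t) of (2p + c - α - β - γ) ) ). Then: (i) if c ≥ p, V(r) = (p-r)^+ + (c-r)^+; (ii) if c < p and r ≤ c, V(r) = p + c - 2r; (iii) if c < p and c < r < p/2, V(r) = p - (p-c)·r/(p-r); (iv) if c < p and p/2 ≤ r ≤ (p+c)/2, V(r) = p + c - 2r. -/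

import Mathlib

open Set Filter Topology

/-- The pair `(β, γ)` lies in the outage region at listening fraction `t`. -/
def RelayOutage (p c r α t β γ : ℝ) : Prop :=
  0 ≤ β ∧ β ≤ p ∧ 0 ≤ γ ∧ γ ≤ c ∧
    min (t * max α γ + (1 - t) * γ) (t * γ + (1 - t) * max β γ) ≤ r

/-- The exponents `2 * p + c - α - β - γ` over the outage region. -/
def relayExponents (p c r α t : ℝ) : Set ℝ :=
  {d : ℝ | ∃ β γ : ℝ, 0 ≤ β ∧ β ≤ p ∧ 0 ≤ γ ∧ γ ≤ c ∧
    min (t * max α γ + (1 - t) * γ) (t * γ + (1 - t) * max β γ) ≤ r ∧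
    d = 2 * p + c - α - β - γ}

/-- The outage exponents attainable by schedules `t`, for fixed receive CSI `α`. -/
def relaySchedules (p c r α : ℝ) : Set ℝ :=
  {w : ℝ | ∃ t : ℝ, 0 ≤ t ∧ t ≤ 1 ∧ w = sInf (relayExponents p c r α t)}

/-- The optimal diversity under receive-only CSI at the relay. -/
noncomputable def relayDiversity (p c r : ℝ) : ℝ :=
  sInf {v : ℝ | ∃ α : ℝ, 0 ≤ α ∧ α ≤ p ∧ v = sSup (relaySchedules p c r α)}

section

variable {p c r α t v : ℝ}

theorem bddBelow_relayExponents : BddBelow (relayExponents p c r α t) := by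
  refine ⟨p - α, ?_⟩
  rintro d ⟨β, γ, _, hβ, _, hγ, _, rfl⟩
  linarith

theorem sInf_relayExponents_le {β γ : ℝ} (h : RelayOutage p c r α t β γ)
    (hv : 2 * p + c - α - β - γ ≤ v) : sInf (relayExponents p c r α t) ≤ v := by
  obtain ⟨h1, h2, h3, h4, h5⟩ := h
  exact (csInf_le bddBelow_relayExponents ⟨β, γ, h1, h2, h3, h4, h5, rfl⟩).trans hv

theorem relayOutage_zero (hp : 0 ≤ p) (hc : 0 ≤ c) (hr : 0 ≤ r) :
    RelayOutage p c r α t 0 0 :=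
  ⟨le_rfl, hp, le_rfl, hc, (min_le_right _ _).trans (by simpa using hr)⟩

theorem le_sInf_relayExponents (hp : 0 ≤ p) (hc : 0 ≤ c) (hr : 0 ≤ r)
    (h : ∀ β γ, RelayOutage p c r α t β γ → v ≤ 2 * p + c - α - β - γ) :
    v ≤ sInf (relayExponents p c r α t) := by
  obtain ⟨h1, h2, h3, h4, h5⟩ := relayOutage_zero (α := α) (t := t) hp hc hr
  refine le_csInf ⟨_, 0, 0, h1, h2, h3, h4, h5, rfl⟩ ?_
  rintro d ⟨β, γ, h1, h2, h3, h4, h5, rfl⟩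
  exact h β γ ⟨h1, h2, h3, h4, h5⟩

theorem le_sSup_relaySchedules (hp : 0 ≤ p) (hc : 0 ≤ c) (hr : 0 ≤ r)
    (ht0 : 0 ≤ t) (ht1 : t ≤ 1)
    (h : ∀ β γ, RelayOutage p c r α t β γ → v ≤ 2 * p + c - α - β - γ) :
    v ≤ sSup (relaySchedules p c r α) := by
  refine (le_sInf_relayExponents hp hc hr h).trans (le_csSup ⟨2 * p + c - α, ?_⟩ ⟨t, ht0, ht1, rfl⟩)
  rintro w ⟨s, _, _, rfl⟩
  exact sInf_relayExponents_le (relayOutage_zero hp hc hr) (by linarith)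

theorem sub_le_sSup_relaySchedules (hp : 0 ≤ p) (hc : 0 ≤ c) (hr : 0 ≤ r) :
    p - α ≤ sSup (relaySchedules p c r α) := by
  refine le_sSup_relaySchedules (t := 0) hp hc hr le_rfl zero_le_one ?_
  rintro β γ ⟨_, hβ, _, hγ, _⟩
  linarith

theorem relayDiversity_le (hp : 0 ≤ p) (hc : 0 ≤ c) (hr : 0 ≤ r)
    (hα0 : 0 ≤ α) (hα : α ≤ p)
    (h : ∀ t, 0 ≤ t → t ≤ 1 →
      ∃ β γ, RelayOutage p c r α t β γ ∧ 2 * p + c - α - β - γ ≤ v) :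
    relayDiversity p c r ≤ v := by
  have hne : (relaySchedules p c r α).Nonempty := ⟨_, 0, le_rfl, zero_le_one, rfl⟩
  refine le_trans (csInf_le ⟨0, ?_⟩ ⟨α, hα0, hα, rfl⟩) (csSup_le hne ?_)
  · rintro v ⟨a, _, ha, rfl⟩
    exact (sub_nonneg.2 ha).trans (sub_le_sSup_relaySchedules hp hc hr)
  · rintro w ⟨t, ht0, ht1, rfl⟩
    obtain ⟨β, γ, hO, hd⟩ := h t ht0 ht1
    exact sInf_relayExponents_le hO hd

theorem le_relayDiversity (hp : 0 ≤ p)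
    (h : ∀ α, 0 ≤ α → α ≤ p → v ≤ sSup (relaySchedules p c r α)) :
    v ≤ relayDiversity p c r := by
  refine le_csInf ⟨_, 0, le_rfl, hp, rfl⟩ ?_
  rintro w ⟨α, h0, h1, rfl⟩
  exact h α h0 h1

/-- The half-listen half-transmit schedule bounds the diversity from below. -/
theorem le_relayDiversity_of_half (hp : 0 ≤ p) (hc : 0 ≤ c) (hr : 0 ≤ r)
    (h : ∀ a b γ : ℝ, a ≤ p → b ≤ p → γ ≤ c → γ ≤ r → a + γ ≤ 2 * r →
      v ≤ 2 * p + c - a - b - γ) : v ≤ relayDiversity p c r := by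
  refine le_relayDiversity hp fun α _ hα => ?_
  refine le_sSup_relaySchedules (t := 1 / 2) hp hc hr (by norm_num) (by norm_num) ?_
  rintro β γ ⟨_, hβ, _, hγ, hO⟩
  rcases min_le_iff.1 hO with hO | hO
  · have h1 := le_max_left α γ
    have h2 := le_max_right α γ
    exact h α β γ hα hβ hγ (by linarith) (by linarith)
  · have h1 := le_max_left β γ
    have h2 := le_max_right β γ
    linarith [h β α γ hβ hα hγ (by linarith) (by linarith)]

theorem sub_two_mul_le_relayDiversity (hp : 0 ≤ p) (hc : 0 ≤ c) (hr : 0 ≤ r) :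
    p + c - 2 * r ≤ relayDiversity p c r :=
  le_relayDiversity_of_half hp hc hr fun a b γ _ _ _ _ _ => by linarith

theorem relayDiversity_of_le (hp : 0 ≤ p) (hc : 0 ≤ c) (hr : 0 ≤ r) (hrp : r ≤ p) (hrc : r ≤ c) :
    relayDiversity p c r = p + c - 2 * r := by
  refine le_antisymm (relayDiversity_le (α := r) hp hc hr hr hrp fun t _ _ =>
    ⟨p, r, ⟨hp, le_rfl, hr, hrc, (min_le_left _ _).trans ?_⟩, by linarith⟩)
    (sub_two_mul_le_relayDiversity hp hc hr)
  rw [max_self]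
  linarith

theorem relayDiversity_of_direct_ge (hp : 0 ≤ p) (hc : 0 ≤ c) (hr : 0 ≤ r) (hpc : p ≤ c) :
    relayDiversity p c r = max (p - r) 0 + max (c - r) 0 := by
  rcases le_total r p with hrp | hpr
  · rw [relayDiversity_of_le hp hc hr hrp (hrp.trans hpc), max_eq_left (by linarith),
      max_eq_left (by linarith)]
    ring
  rw [max_eq_right (a := p - r) (by linarith), zero_add]
  refine le_antisymm (relayDiversity_le (α := p) hp hc hr hp le_rfl fun t _ _ =>
    ⟨p, min c r, ⟨hp, le_rfl, le_min hc hr, min_le_left _ _, (min_le_left _ _).trans ?_⟩, ?_⟩)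
    (le_relayDiversity_of_half hp hc hr fun a b γ _ _ _ _ _ =>
      max_le (by linarith) (by linarith))
  · rw [max_eq_right (le_min hpc hpr)]
    linarith [min_le_right c r]
  · rcases le_total c r with h | h
    · rw [min_eq_left h]
      linarith [le_max_right (c - r) 0]
    · rw [min_eq_right h]
      linarith [le_max_left (c - r) 0]

theorem relayDiversity_of_half_le (hp : 0 ≤ p) (hc : 0 ≤ c) (hr : 0 ≤ r) (hcp : c < p)
    (hpr : p / 2 ≤ r) (hrpc : r ≤ (p + c) / 2) :
    relayDiversity p c r = p + c - 2 * r := by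
  refine le_antisymm (relayDiversity_le (α := p) hp hc hr hp le_rfl fun t ht0 ht1 =>
    ⟨p, 2 * r - p, ⟨hp, le_rfl, by linarith, by linarith, ?_⟩, by linarith⟩)
    (sub_two_mul_le_relayDiversity hp hc hr)
  rw [max_eq_left (by linarith), min_le_iff]
  rcases le_total t (1 / 2) with h | h
  · left
    nlinarith [mul_nonneg (sub_nonneg.2 h) (show 0 ≤ p - r by linarith)]
  · right
    nlinarith [mul_nonneg (sub_nonneg.2 h) (show 0 ≤ p - r by linarith)]

/-- If the relay listens long enough to decode, only the relay-to-destination cut is in outage. -/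
theorem RelayOutage.transmit_le {β γ : ℝ} (ht0 : 0 ≤ t) (ht1 : t ≤ 1) (ht : r < t * α)
    (h : RelayOutage p c r α t β γ) : t * γ + (1 - t) * β ≤ r := by
  obtain ⟨_, _, hγ, _, hO⟩ := h
  rcases min_le_iff.1 hO with hO | hO
  · nlinarith [mul_le_mul_of_nonneg_left (le_max_left α γ) ht0,
      mul_nonneg (sub_nonneg.2 ht1) hγ]
  · linarith [mul_le_mul_of_nonneg_left (le_max_left β γ) (sub_nonneg.2 ht1)]

/-- Dynamic decode-and-forward: letting `t` decrease to the decoding time `r / α`. -/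
theorem le_sSup_relaySchedules_of_continuousAt (hp : 0 ≤ p) (hc : 0 ≤ c) (hr : 0 ≤ r)
    {b : ℝ} {g : ℝ → ℝ} (hα : 0 < α) (hb : r / α < b) (hb1 : b ≤ 1)
    (hg : ContinuousAt g (r / α)) (hv : v ≤ g (r / α))
    (h : ∀ t, r / α < t → t < b → ∀ β γ, β ≤ p → γ ≤ c → t * γ + (1 - t) * β ≤ r →
      g t ≤ 2 * p + c - α - β - γ) :
    v ≤ sSup (relaySchedules p c r α) := by
  refine hv.trans (le_of_tendsto (hg.tendsto.mono_left nhdsWithin_le_nhds :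
    Tendsto g (𝓝[>] (r / α)) _) ?_)
  filter_upwards [Ioo_mem_nhdsGT hb] with t ht
  have ht0 : 0 ≤ t := (div_nonneg hr hα.le).trans ht.1.le
  have ht1 : t ≤ 1 := ht.2.le.trans hb1
  refine le_sSup_relaySchedules hp hc hr ht0 ht1 fun β γ hO => ?_
  exact h t ht.1 ht.2 β γ hO.2.1 hO.2.2.2.1
    (RelayOutage.transmit_le ht0 ht1 ((div_lt_iff₀ hα).1 ht.1) hO)

theorem relayDiversity_of_lt_half (hp : 0 ≤ p) (hc : 0 ≤ c) (hr : 0 ≤ r) (hcp : c < p)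
    (hcr : c < r) (hrp : r < p / 2) :
    relayDiversity p c r = p - (p - c) * r / (p - r) := by
  have hpr : 0 < p - r := by linarith
  have hp0 : 0 < p := by linarith
  have hr0 : 0 < r := by linarith
  obtain ⟨b, hb⟩ : ∃ b, b = (p - c) * r / (p - r) := ⟨_, rfl⟩
  have hbm : b * (p - r) = (p - c) * r := by rw [hb]; field_simp
  have hrb : r ≤ b := by
    rw [hb, le_div_iff₀ hpr]
    nlinarith
  have hb2 : b ≤ 2 * r := by
    rw [hb, div_le_iff₀ hpr]
    nlinarith
  rw [← hb]
  refine le_antisymm (relayDiversity_le (α := p) hp hc hr hp le_rfl fun t ht0 ht1 => ?_)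
    (le_relayDiversity hp fun α hα0 hα => ?_)
  · rcases le_total (t * p) r with ht | ht
    · refine ⟨p, 0, ⟨hp, le_rfl, le_rfl, hc, (min_le_left _ _).trans ?_⟩, ?_⟩
      · rw [max_eq_left hp]
        linarith
      · nlinarith
    · refine ⟨b, c, ⟨by linarith, by linarith, hc, le_rfl, (min_le_right _ _).trans ?_⟩,
        by linarith⟩
      rw [max_eq_left (by linarith)]
      have h1 : (t * p - r) * (b - c) ≥ 0 := mul_nonneg (by linarith) (by linarith)
      have h2 : p * (t * c + (1 - t) * b) ≤ p * r := by linarith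
      exact le_of_mul_le_mul_left h2 hp0
  · rcases le_total α b with hαb | hbα
    · exact (by linarith : p - b ≤ p - α).trans (sub_le_sSup_relaySchedules hp hc hr)
    have hα0' : 0 < α := by linarith
    rcases le_or_gt α (2 * r) with hα2 | hα2
    · have hhalf : 1 / 2 ≤ r / α := by
        rw [div_le_div_iff₀ two_pos hα0']
        linarith
      have hrα : r < α := by
        refine lt_of_lt_of_le ?_ hbα
        rw [hb, lt_div_iff₀ hpr]
        nlinarith
      refine le_sSup_relaySchedules_of_continuousAt (b := 1)
        (g := fun t => c - α + (p - r) / t) hp hc hr hα0' ((div_lt_one hα0').2 hrα) le_rfl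
        ?_ ?_ ?_
      · exact continuousAt_const.add
          (continuousAt_const.div continuousAt_id (div_pos hr0 hα0').ne')
      · have h1 : (p - r) / (r / α) = (p - r) * α / r := by field_simp
        have h2 : p - b - c + α ≤ (p - r) * α / r := by
          rw [le_div_iff₀ hr0]
          nlinarith [mul_nonneg (sub_nonneg.2 hbα) (show 0 ≤ p - 2 * r by linarith)]
        simp only [h1]
        linarith
      · intro t ht _ β γ hβ hγ hO
        have ht0 : 0 < t := by linarith
        have h1 : (p - r) / t ≤ 2 * p - β - γ := by
          rw [div_le_iff₀ ht0]
          nlinarith [mul_nonneg (show 0 ≤ 2 * t - 1 by linarith) (sub_nonneg.2 hβ)]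
        linarith
    · have hhalf : r / α < 1 / 2 := by
        rw [div_lt_div_iff₀ hα0' two_pos]
        linarith
      have hαr : 0 < α - r := by linarith
      refine le_sSup_relaySchedules_of_continuousAt (b := 1 / 2)
        (g := fun t => 2 * p - α - (r - t * c) / (1 - t)) hp hc hr hα0' hhalf (by norm_num)
        ?_ ?_ ?_
      · refine continuousAt_const.sub (ContinuousAt.div ?_ ?_ (by linarith))
        · fun_prop
        · fun_prop
      · have h1 : (r - r / α * c) / (1 - r / α) = r * (α - c) / (α - r) := by
          field_simp
        have h2 : r * (α - c) / (α - r) ≤ p - α + b := by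
          rw [div_le_iff₀ hαr]
          have h4 : r * (α - c) * (p - r) ≤ (p - α + b) * (α - r) * (p - r) := by
            have h5 : (p - α + b) * (α - r) * (p - r) - r * (α - c) * (p - r)
              = (p - α) * ((α - r) * (p - r) - r * (r - c)) := by
              linear_combination (α - r) * hbm
            have h6 : 0 ≤ (α - r) * (p - r) - r * (r - c) := by nlinarith
            nlinarith [mul_nonneg (sub_nonneg.2 hα) h6]
          exact le_of_mul_le_mul_right h4 hpr
        simp only [h1]
        linarith
      · intro t ht ht2 β γ hβ hγ hO
        have h1 : β + γ - c ≤ (r - t * c) / (1 - t) := by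
          rw [le_div_iff₀ (by linarith)]
          nlinarith [mul_nonneg (show 0 ≤ 1 - 2 * t by linarith) (sub_nonneg.2 hγ)]
        linarith

end


/-- Theorem 1: the optimal DMT of the half-duplex (p,p,c)-relay channel under
receive-only CSI at the relay, expressed as an inf-sup-inf. -/
theorem relay_DMT_receiveCSI (p c r : ℝ) (hp : 0 ≤ p) (hc : 0 ≤ c) (hr : 0 ≤ r) :
    let V : ℝ :=
      sInf {v : ℝ | ∃ α : ℝ, 0 ≤ α ∧ α ≤ p ∧
        v = sSup {w : ℝ | ∃ t : ℝ, 0 ≤ t ∧ t ≤ 1 ∧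
          w = sInf {d : ℝ | ∃ β γ : ℝ, 0 ≤ β ∧ β ≤ p ∧ 0 ≤ γ ∧ γ ≤ c ∧
            min (t * max α γ + (1 - t) * γ) (t * γ + (1 - t) * max β γ) ≤ r ∧
            d = 2 * p + c - α - β - γ}}}
    (p ≤ c → V = max (p - r) 0 + max (c - r) 0) ∧
    (c < p → r ≤ c → V = p + c - 2 * r) ∧
    (c < p → c < r → r < p / 2 → V = p - (p - c) * r / (p - r)) ∧
    (c < p → p / 2 ≤ r → r ≤ (p + c) / 2 → V = p + c - 2 * r) := by
  intro V
  have hV : V = relayDiversity p c r := rfl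
  rw [hV]
  exact ⟨relayDiversity_of_direct_ge hp hc hr,
    fun hcp hrc => relayDiversity_of_le hp hc hr (hrc.trans hcp.le) hrc,
    relayDiversity_of_lt_half hp hc hr,
    relayDiversity_of_half_le hp hc hr⟩
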